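/- For every sequence k = k(n) of positive integers with k(n) ≤ ln⁴ n, the probability that in the uniformly random forest F(n,k) the roots 1,…,k have, in total, more than k(1 + 1/ln n) + 2 ln² n neighbors is o(n^{−3}); that is, n³ times this probability tends to 0 as n → ∞. -/

import Mathlib

namespace FODef

/-- `F` belongs to `F_{n,k}`: it is a forest on `{0, …, n-1}` consisting of `k` trees
rooted at the first `k` vertices, i.e. it is acyclic and each component contains exactly
one of the first `k` vertices (equivalently, every vertex is connected to exactly one
root). -/
def IsRootedForest (n k : ℕ) (F : SimpleGraph (Fin n)) : Prop :=
  F.IsAcyclic ∧ ∀ v : Fin n, ∃! r : Fin n, r.val < k ∧ F.Reachable v r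

open Classical in
/-- The probability of the event `E` for a forest chosen uniformly at random
from `F_{n,k}`. -/
noncomputable def rfProb (n k : ℕ) (E : Set (SimpleGraph (Fin n))) : ℝ :=
  ((Finset.univ.filter
      (fun F : SimpleGraph (Fin n) => IsRootedForest n k F ∧ F ∈ E)).card : ℝ) /
  ((Finset.univ.filter (fun F : SimpleGraph (Fin n) => IsRootedForest n k F)).card : ℝ)

open Classical in
/-- The expectation of `X` for a forest chosen uniformly at random from `F_{n,k}`. -/
noncomputable def rfExp (n k : ℕ) (X : SimpleGraph (Fin n) → ℝ) : ℝ :=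
  (∑ F ∈ Finset.univ.filter (fun F : SimpleGraph (Fin n) => IsRootedForest n k F), X F) /
  ((Finset.univ.filter (fun F : SimpleGraph (Fin n) => IsRootedForest n k F)).card : ℝ)

/-- Degree of a vertex. -/
noncomputable def deg {V : Type} (G : SimpleGraph V) (v : V) : ℕ :=
  Nat.card {w // G.Adj v w}

end FODef

open Filter FODef

namespace FODef

section ParentMap

variable {V : Type*}

/-- A map fixing the points of `R` under which every point is eventually sent into `R`. -/
def IsParentMap (R : Finset V) (p : V → V) : Prop :=
  (∀ r ∈ R, p r = r) ∧ ∀ v, ∃ j, p^[j] v ∈ R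

/-- The graph joining each vertex to its image under `p`. -/
def parentGraph (p : V → V) : SimpleGraph V :=
  SimpleGraph.fromRel fun u v => p u = v

lemma parentGraph_adj {p : V → V} {u v : V} :
    (parentGraph p).Adj u v ↔ u ≠ v ∧ (p u = v ∨ p v = u) := by
  simp [parentGraph]

namespace IsParentMap

variable {R : Finset V} {p : V → V}

lemma iterate_root (h : IsParentMap R p) {r : V} (hr : r ∈ R) (j : ℕ) : p^[j] r = r :=
  Function.iterate_fixed (h.1 r hr) j

lemma iterate_mem_of_le (h : IsParentMap R p) {v : V} {i j : ℕ} (hij : i ≤ j)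
    (hi : p^[i] v ∈ R) : p^[j] v = p^[i] v := by
  obtain ⟨d, rfl⟩ := Nat.exists_eq_add_of_le' hij
  rw [Function.iterate_add_apply, h.iterate_root hi]

lemma iterate_succ_ne (h : IsParentMap R p) {v : V} (hv : v ∉ R) (j : ℕ) :
    p^[j] (p v) ≠ v := by
  intro hj
  obtain ⟨i, hi⟩ := h.2 v
  have hper : Function.IsPeriodicPt p (j + 1) v := hj
  have h1 : p^[(j + 1) * i] v = v := hper.mul_const i
  rw [h.iterate_mem_of_le (Nat.le_mul_of_pos_left i j.succ_pos) hi] at h1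
  exact hv (h1 ▸ hi)

lemma apply_ne (h : IsParentMap R p) {v : V} (hv : v ∉ R) : p v ≠ v :=
  h.iterate_succ_ne hv 0

lemma notMem_of_apply_ne (h : IsParentMap R p) {v : V} (hv : p v ≠ v) : v ∉ R :=
  fun hr => hv (h.1 v hr)

lemma parentGraph_adj_apply (h : IsParentMap R p) {v : V} (hv : v ∉ R) :
    (parentGraph p).Adj v (p v) :=
  parentGraph_adj.2 ⟨(h.apply_ne hv).symm, Or.inl rfl⟩

lemma parentGraph_isBridge (h : IsParentMap R p) {v : V} (hv : v ∉ R) :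
    (parentGraph p).IsBridge s(v, p v) := by
  rw [SimpleGraph.isBridge_iff]
  rintro ⟨w⟩
  have key : ∀ a b, ((parentGraph p).deleteEdges {s(v, p v)}).Walk a b →
      (∃ j, p^[j] a = v) → ∃ j, p^[j] b = v := by
    intro a b w
    induction w with
    | nil => exact id
    | @cons a c b hac _ ih =>
      rintro ⟨j, hj⟩
      apply ih
      rw [SimpleGraph.deleteEdges_adj, parentGraph_adj] at hac
      obtain ⟨⟨_, hc | hc⟩, hne⟩ := hac
      · cases j with
        | zero =>
          obtain rfl : a = v := hj
          exact absurd (by simp [hc]) hne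
        | succ j => exact ⟨j, by rw [← hc]; exact hj⟩
      · exact ⟨j + 1, by rw [Function.iterate_succ_apply, hc, hj]⟩
  obtain ⟨j, hj⟩ := key _ _ w ⟨0, rfl⟩
  exact h.iterate_succ_ne hv j hj

lemma parentGraph_isAcyclic (h : IsParentMap R p) : (parentGraph p).IsAcyclic := by
  rw [SimpleGraph.isAcyclic_iff_forall_adj_isBridge]
  intro u v huv
  obtain ⟨hne, rfl | rfl⟩ := parentGraph_adj.1 huv
  · exact h.parentGraph_isBridge (h.notMem_of_apply_ne hne.symm)
  · rw [Sym2.eq_swap]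
    exact h.parentGraph_isBridge (h.notMem_of_apply_ne hne)

lemma parentGraph_reachable_iterate (p : V → V) (v : V) (j : ℕ) :
    (parentGraph p).Reachable v (p^[j] v) := by
  induction j with
  | zero => exact .refl v
  | succ j ih =>
    rw [Function.iterate_succ_apply']
    refine ih.trans ?_
    by_cases hf : p^[j] v = p (p^[j] v)
    · rw [← hf]
    · exact (parentGraph_adj.2 ⟨hf, Or.inl rfl⟩).reachable

lemma exists_iterate_eq_of_reachable (h : IsParentMap R p) {r : V} (hr : r ∈ R) {v : V}
    (hv : (parentGraph p).Reachable v r) : ∃ j, p^[j] v = r := by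
  obtain ⟨w⟩ := hv
  induction w with
  | nil => exact ⟨0, rfl⟩
  | @cons a c r hac _ ih =>
    obtain ⟨j, hj⟩ := ih hr
    obtain ⟨-, hc | hc⟩ := parentGraph_adj.1 hac
    · exact ⟨j + 1, by rw [Function.iterate_succ_apply, hc, hj]⟩
    · refine ⟨j, ?_⟩
      rw [← hc, ← Function.iterate_succ_apply, Function.iterate_succ_apply', hj, h.1 r hr]

lemma existsUnique_root (h : IsParentMap R p) (v : V) :
    ∃! r, r ∈ R ∧ (parentGraph p).Reachable v r := by
  obtain ⟨j, hj⟩ := h.2 v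
  refine ⟨p^[j] v, ⟨hj, parentGraph_reachable_iterate p v j⟩, ?_⟩
  rintro r ⟨hr, hvr⟩
  obtain ⟨i, rfl⟩ := h.exists_iterate_eq_of_reachable hr hvr
  rcases le_total i j with hij | hij
  · exact (h.iterate_mem_of_le hij hr).symm
  · exact h.iterate_mem_of_le hij hj

lemma eq_of_parentGraph_eq {q : V → V} (hp : IsParentMap R p) (hq : IsParentMap R q)
    (hpq : parentGraph p = parentGraph q) : p = q := by
  have key : ∀ j v, p^[j] v ∈ R → p v = q v := by
    intro j
    induction j with
    | zero =>
      intro v hv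
      rw [hp.1 v hv, hq.1 v hv]
    | succ j ih =>
      intro v hj
      by_cases hv : v ∈ R
      · rw [hp.1 v hv, hq.1 v hv]
      have hadj := hp.parentGraph_adj_apply hv
      rw [hpq, parentGraph_adj] at hadj
      obtain ⟨-, h1 | h1⟩ := hadj
      · exact h1.symm
      · rw [← ih (p v) hj] at h1
        exact absurd h1 (hp.iterate_succ_ne hv 1)
  funext v
  obtain ⟨j, hj⟩ := hp.2 v
  exact key j v hj

end IsParentMap

/-- An acyclic graph in which each vertex is connected to exactly one element of `R` is the
graph of a parent map. -/
lemma exists_isParentMap_parentGraph_eq {R : Finset V} {F : SimpleGraph V}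
    (hF : F.IsAcyclic) (hR : ∀ v, ∃! r, r ∈ R ∧ F.Reachable v r) :
    ∃ p, IsParentMap R p ∧ parentGraph p = F := by
  choose ρ hρ hρu using hR
  have hpath : ∀ v, ∃ P : F.Walk v (ρ v), P.IsPath := fun v => by
    classical
    obtain ⟨w⟩ := (hρ v).2
    exact ⟨w.bypass, w.bypass_isPath⟩
  choose P hP using hpath
  have hroot : ∀ {u v}, F.Reachable u v → ρ u = ρ v := fun {u v} h =>
    hρu v _ ⟨(hρ u).1, h.symm.trans (hρ u).2⟩
  have hsnd : ∀ {v r} (Q : F.Walk v r), r ∈ R → Q.IsPath → (P v).snd = Q.snd := by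
    intro v r Q hr hQ
    obtain rfl : r = ρ v := hρu v r ⟨hr, ⟨Q⟩⟩
    have := (hF.subsingleton_path v (ρ v)).elim ⟨P v, hP v⟩ ⟨Q, hQ⟩
    rw [Subtype.mk.injEq] at this
    rw [this]
  refine ⟨fun v => (P v).snd, ⟨?_, ?_⟩, ?_⟩
  · intro r hr
    exact hsnd (SimpleGraph.Walk.nil : F.Walk r r) hr SimpleGraph.Walk.IsPath.nil
  · intro v
    have key : ∀ (v r : V) (Q : F.Walk v r), r ∈ R → Q.IsPath →
        ∃ j, (fun v => (P v).snd)^[j] v ∈ R := by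
      intro v r Q
      induction Q with
      | nil => exact fun hr _ => ⟨0, hr⟩
      | @cons a c r hac Q ih =>
        intro hr hQ
        obtain ⟨j, hj⟩ := ih hr hQ.of_cons
        refine ⟨j + 1, ?_⟩
        rw [Function.iterate_succ_apply]
        simp only [hsnd (SimpleGraph.Walk.cons hac Q) hr hQ, SimpleGraph.Walk.snd_cons]
        exact hj
    exact key v _ (P v) (hρ v).1 (hP v)
  · have hadj : ∀ {u v}, u ≠ v → (P u).snd = v → F.Adj u v := by
      rintro u v hne rfl
      have hnil : ¬ (P u).Nil := fun hn => hne (by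
        have h1 : (P u).snd = u := SimpleGraph.Walk.getVert_of_length_le _ (by
          rw [SimpleGraph.Walk.length_eq_zero_iff.2 hn]; exact zero_le_one) |>.trans hn.eq.symm
        exact h1.symm)
      exact (P u).adj_snd hnil
    ext u v
    rw [parentGraph_adj]
    constructor
    · rintro ⟨hne, h | h⟩
      · exact hadj hne h
      · exact (hadj hne.symm h).symm
    · intro huv
      refine ⟨huv.ne, ?_⟩
      classical
      by_cases hv : v ∈ (P u).support
      · left
        exact (hF.eq_snd_of_adj_start (hP u) huv hv).symm
      · right
        have := hsnd (SimpleGraph.Walk.cons huv.symm (P u)) (hρ u).1 ((hP u).cons hv)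
        simpa using this

end ParentMap

section Counting

variable {V : Type*} [DecidableEq V] {R : Finset V} {p : V → V}

namespace IsParentMap

lemma iterate_update_eq {v w x : V} (h : ∀ j, p^[j] x ≠ v) (j : ℕ) :
    (Function.update p v w)^[j] x = p^[j] x := by
  induction j with
  | zero => rfl
  | succ j ih =>
    rw [Function.iterate_succ_apply', Function.iterate_succ_apply', ih,
      Function.update_of_ne (h j)]

/-- Moving the subtree of `v` below a vertex `w` outside of it. -/
lemma update (h : IsParentMap R p) {v w : V} (hv : v ∉ R) (hw : ∀ j, p^[j] w ≠ v) :
    IsParentMap R (Function.update p v w) := by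
  refine ⟨fun r hr => ?_, ?_⟩
  · rw [Function.update_of_ne (ne_of_mem_of_not_mem hr hv), h.1 r hr]
  have key : ∀ i u, p^[i] u ∈ R → ∃ j, (Function.update p v w)^[j] u ∈ R := by
    intro i
    induction i with
    | zero => exact fun u hu => ⟨0, hu⟩
    | succ i ih =>
      intro u hu
      by_cases huv : u = v
      · subst huv
        obtain ⟨j, hj⟩ := h.2 w
        refine ⟨j + 1, ?_⟩
        rwa [Function.iterate_succ_apply, Function.update_self, iterate_update_eq hw]
      · obtain ⟨j, hj⟩ := ih (p u) hu
        refine ⟨j + 1, ?_⟩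
        rwa [Function.iterate_succ_apply, Function.update_of_ne huv]
  intro u
  obtain ⟨i, hi⟩ := h.2 u
  exact key i u hi

end IsParentMap

variable [Fintype V]

/-- The vertices outside `R` whose parent lies in `R`. -/
def rootChildren (R : Finset V) (p : V → V) : Finset V :=
  Finset.univ.filter fun v => v ∉ R ∧ p v ∈ R

lemma mem_rootChildren {v : V} : v ∈ rootChildren R p ↔ v ∉ R ∧ p v ∈ R := by
  simp [rootChildren]

lemma card_rootChildren_add (R : Finset V) (p : V → V) :
    (rootChildren R p).card + (Finset.univ.filter fun v => v ∉ R ∧ p v ∉ R).card = Rᶜ.card := by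
  rw [← Finset.card_filter_add_card_filter_not (s := Rᶜ) (p := fun v => p v ∈ R)]
  congr 2 <;> ext v <;> simp [rootChildren]

lemma rootChildren_update {v w : V} (hw : w ∉ R) :
    rootChildren R (Function.update p v w) = (rootChildren R p).erase v := by
  ext u
  by_cases huv : u = v
  · subst huv
    simp [mem_rootChildren, hw]
  · simp [mem_rootChildren, huv]

lemma rootChildren_update_root {v r : V} (hv : v ∉ R) (hr : r ∈ R) :
    rootChildren R (Function.update p v r) = insert v (rootChildren R p) := by
  ext u
  by_cases huv : u = v
  · subst huv
    simp [mem_rootChildren, hv, hr]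
  · simp [mem_rootChildren, huv]

open Classical in
lemma IsParentMap.card_rootChildren_ancestor (h : IsParentMap R p) {w : V} (hw : w ∉ R) :
    ((rootChildren R p).filter fun v => ∃ j, p^[j] w = v).card = 1 := by
  rw [Finset.card_eq_one]
  have hex := h.2 w
  obtain ⟨i, hi⟩ : ∃ i, Nat.find hex = i + 1 := by
    refine Nat.exists_eq_succ_of_ne_zero fun h0 => hw ?_
    have := Nat.find_spec hex
    rwa [h0] at this
  have hi1 : p^[i] w ∉ R := Nat.find_min hex (by omega)
  have hi2 : p^[i + 1] w ∈ R := hi ▸ Nat.find_spec hex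
  refine ⟨p^[i] w, ?_⟩
  ext v
  simp only [Finset.mem_filter, Finset.mem_singleton, mem_rootChildren]
  constructor
  · rintro ⟨⟨hv, hpv⟩, j, rfl⟩
    rw [← Function.iterate_succ_apply' p] at hpv
    rcases lt_trichotomy i j with hij | rfl | hij
    · exact absurd (h.iterate_mem_of_le hij hi2 ▸ hi2) hv
    · rfl
    · exact absurd (h.iterate_mem_of_le hij hpv ▸ hpv) hi1
  · rintro rfl
    exact ⟨⟨hi1, by rwa [← Function.iterate_succ_apply' p]⟩, i, rfl⟩

open Classical in
/-- The parent maps for which the roots have `m` children in total. -/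
noncomputable def parentMaps (R : Finset V) (m : ℕ) : Finset (V → V) :=
  Finset.univ.filter fun p => IsParentMap R p ∧ (rootChildren R p).card = m

lemma mem_parentMaps {m : ℕ} :
    p ∈ parentMaps R m ↔ IsParentMap R p ∧ (rootChildren R p).card = m := by
  simp [parentMaps]

open Classical in
/-- The ways to move the subtree of a child of a root below a vertex outside of `R`. -/
noncomputable def demotions (R : Finset V) (p : V → V) : Finset (V × V) :=
  ((rootChildren R p) ×ˢ Rᶜ).filter fun x => ∀ j, p^[j] x.2 ≠ x.1

lemma mem_demotions {x : V × V} :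
    x ∈ demotions R p ↔ (x.1 ∉ R ∧ p x.1 ∈ R) ∧ x.2 ∉ R ∧ ∀ j, p^[j] x.2 ≠ x.1 := by
  simp [demotions, mem_rootChildren, and_assoc]

lemma IsParentMap.card_demotions (h : IsParentMap R p) :
    (demotions R p).card = Rᶜ.card * ((rootChildren R p).card - 1) := by
  classical
  rw [demotions, Finset.card_filter, Finset.sum_product_right,
    Finset.sum_const_nat fun w hw => ?_]
  rw [← Finset.card_filter, ← h.card_rootChildren_ancestor (Finset.mem_compl.1 hw),
    ← Finset.card_filter_add_card_filter_not (s := rootChildren R p)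
      (p := fun v => ∃ j, p^[j] w = v), Nat.add_sub_cancel_left]
  simp

/-- The ways to move the subtree of a vertex at distance at least two from `R` below a vertex
of `R`. -/
def promotions (R : Finset V) (p : V → V) : Finset (V × V) :=
  (Finset.univ.filter fun v => v ∉ R ∧ p v ∉ R) ×ˢ R

lemma mem_promotions {x : V × V} :
    x ∈ promotions R p ↔ (x.1 ∉ R ∧ p x.1 ∉ R) ∧ x.2 ∈ R := by
  simp [promotions]

lemma card_promotions (R : Finset V) (p : V → V) :
    (promotions R p).card = (Rᶜ.card - (rootChildren R p).card) * R.card := by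
  rw [promotions, Finset.card_product, ← card_rootChildren_add R p, Nat.add_sub_cancel_left]

lemma card_sigma_demotions (R : Finset V) (m : ℕ) :
    ((parentMaps R (m + 1)).sigma fun p => demotions R p).card =
      ((parentMaps R m).sigma fun p => promotions R p).card := by
  refine Finset.card_nbij'
    (fun x => ⟨Function.update x.1 x.2.1 x.2.2, (x.2.1, x.1 x.2.1)⟩)
    (fun x => ⟨Function.update x.1 x.2.1 x.2.2, (x.2.1, x.1 x.2.1)⟩) ?_ ?_ ?_ ?_
  · rintro ⟨p, v, w⟩ hx
    simp only [Finset.coe_sigma, Set.mem_sigma_iff, Finset.mem_coe, mem_parentMaps,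
      mem_demotions, mem_promotions] at hx ⊢
    obtain ⟨⟨hp, hm⟩, ⟨hv, hpv⟩, hw, hwv⟩ := hx
    refine ⟨⟨hp.update hv hwv, ?_⟩, ⟨hv, by simpa using hw⟩, hpv⟩
    rw [rootChildren_update hw, Finset.card_erase_of_mem (mem_rootChildren.2 ⟨hv, hpv⟩), hm,
      Nat.add_sub_cancel]
  · rintro ⟨p, v, r⟩ hx
    simp only [Finset.coe_sigma, Set.mem_sigma_iff, Finset.mem_coe, mem_parentMaps,
      mem_demotions, mem_promotions] at hx ⊢
    obtain ⟨⟨hp, hm⟩, ⟨hv, hpv⟩, hr⟩ := hx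
    have hrv : ∀ j, p^[j] r ≠ v := fun j => by
      rw [hp.iterate_root hr]
      exact fun h => hv (h ▸ hr)
    refine ⟨⟨hp.update hv hrv, ?_⟩, ⟨hv, by simpa using hr⟩, hpv, fun j => ?_⟩
    · rw [rootChildren_update_root hv hr, Finset.card_insert_of_notMem
        (fun h => hpv (mem_rootChildren.1 h).2), hm]
    · rw [IsParentMap.iterate_update_eq (hp.iterate_succ_ne hv)]
      exact hp.iterate_succ_ne hv j
  · rintro ⟨p, v, w⟩ _
    simp
  · rintro ⟨p, v, w⟩ _
    simp

lemma card_parentMaps_succ (R : Finset V) (m : ℕ) :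
    (parentMaps R (m + 1)).card * (Rᶜ.card * m) =
      (parentMaps R m).card * ((Rᶜ.card - m) * R.card) := by
  have h := card_sigma_demotions R m
  rw [Finset.card_sigma, Finset.card_sigma] at h
  rw [Finset.sum_const_nat (m := Rᶜ.card * m) fun p hp => ?_,
    Finset.sum_const_nat (m := (Rᶜ.card - m) * R.card) fun p hp => ?_] at h
  · exact h
  · obtain ⟨-, hm⟩ := mem_parentMaps.1 hp
    rw [card_promotions, hm]
  · obtain ⟨hp, hm⟩ := mem_parentMaps.1 hp
    rw [hp.card_demotions, hm, Nat.add_sub_cancel]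

lemma card_parentMaps_eq (R : Finset V) (j : ℕ) :
    (parentMaps R (j + 1)).card * Rᶜ.card ^ j =
      (parentMaps R 1).card * ((Rᶜ.card - 1).choose j * R.card ^ j) := by
  induction j with
  | zero => simp
  | succ j ih =>
    have h := card_parentMaps_succ R (j + 1)
    have hc := Nat.choose_succ_right_eq (Rᶜ.card - 1) j
    rw [Nat.sub_sub, Nat.add_comm 1 j] at hc
    refine Nat.eq_of_mul_eq_mul_right (Nat.add_one_pos j) ?_
    calc _ = ((parentMaps R (j + 1 + 1)).card * (Rᶜ.card * (j + 1))) * Rᶜ.card ^ j := by ring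
      _ = ((parentMaps R (j + 1)).card * Rᶜ.card ^ j) * ((Rᶜ.card - (j + 1)) * R.card) := by
        rw [h]; ring
      _ = (parentMaps R 1).card * R.card ^ (j + 1) *
            ((Rᶜ.card - 1).choose j * (Rᶜ.card - (j + 1))) := by
        rw [ih]; ring
      _ = _ := by rw [← hc]; ring

lemma card_parentMaps_zero (hR : R.Nonempty) (hRc : Rᶜ.Nonempty) :
    (parentMaps R 0).card = 0 := by
  have h := card_parentMaps_succ R 0
  simpa [hR.card_ne_zero, hRc.ne_empty, hR.ne_empty] using h

open Classical in
/-- The generating function of the number of children of the roots. -/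
lemma sum_pow_card_rootChildren (hR : R.Nonempty) (hRc : Rᶜ.Nonempty) (x : ℝ) :
    ∑ p ∈ Finset.univ.filter (IsParentMap R), x ^ (rootChildren R p).card =
      (parentMaps R 1).card * (x * (1 + x * (R.card / Rᶜ.card)) ^ (Rᶜ.card - 1)) := by
  have hN : (Rᶜ.card : ℝ) ≠ 0 := by exact_mod_cast hRc.card_ne_zero
  obtain ⟨M, hM⟩ := Nat.exists_eq_succ_of_ne_zero hRc.card_ne_zero
  have hmaps : ∀ p ∈ Finset.univ.filter (IsParentMap R),
      (rootChildren R p).card ∈ Finset.range (M + 1 + 1) := fun p _ => by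
    have := card_rootChildren_add R p
    rw [Finset.mem_range]
    omega
  have hfib : ∀ m, ∑ p ∈ Finset.univ.filter (IsParentMap R) with (rootChildren R p).card = m,
      x ^ (rootChildren R p).card = (parentMaps R m).card * x ^ m := fun m => by
    rw [Finset.filter_filter, ← parentMaps, Finset.sum_congr rfl
      (fun p hp => by rw [(mem_parentMaps.1 hp).2]), Finset.sum_const, nsmul_eq_mul]
  rw [← Finset.sum_fiberwise_of_maps_to hmaps, Finset.sum_congr rfl (fun m _ => hfib m),
    Finset.sum_range_succ', card_parentMaps_zero hR hRc, Nat.cast_zero, zero_mul, add_zero,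
    add_comm (1 : ℝ), add_pow, Finset.mul_sum, Finset.mul_sum]
  rw [show Rᶜ.card - 1 + 1 = M + 1 by omega]
  refine Finset.sum_congr rfl fun j _ => ?_
  have h : ((parentMaps R (j + 1)).card : ℝ) * (Rᶜ.card : ℝ) ^ j =
      (parentMaps R 1).card * ((Rᶜ.card - 1).choose j * (R.card : ℝ) ^ j) := by
    exact_mod_cast card_parentMaps_eq R j
  rw [← eq_div_iff (pow_ne_zero j hN)] at h
  rw [h, mul_pow, div_pow, one_pow]
  ring

open Classical in
lemma card_isParentMap (hR : R.Nonempty) (hRc : Rᶜ.Nonempty) :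
    ((Finset.univ.filter (IsParentMap R)).card : ℝ) =
      (parentMaps R 1).card * (1 + (R.card : ℝ) / Rᶜ.card) ^ (Rᶜ.card - 1) := by
  simpa using sum_pow_card_rootChildren hR hRc 1

open Classical in
/-- Chernoff bound for the number of children of the roots. -/
lemma card_filter_rootChildren_le (hR : R.Nonempty) (hRc : Rᶜ.Nonempty) (T : ℝ) {t : ℝ}
    (ht : 0 ≤ t) :
    ((Finset.univ.filter fun p => IsParentMap R p ∧ T < (rootChildren R p).card).card : ℝ) ≤
      Real.exp (t * (1 - T) + R.card * (Real.exp t - 1)) *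
        (Finset.univ.filter (IsParentMap R)).card := by
  have hN : (0 : ℝ) < Rᶜ.card := by exact_mod_cast hRc.card_pos
  set c : ℝ := (R.card : ℝ) / Rᶜ.card with hc
  have hc0 : 0 ≤ c := by positivity
  have hx : 0 ≤ Real.exp t - 1 := by linarith [Real.one_le_exp ht]
  have h1 : ((Finset.univ.filter fun p => IsParentMap R p ∧ T < (rootChildren R p).card).card : ℝ)
      * Real.exp (t * T) ≤
        ∑ p ∈ Finset.univ.filter (IsParentMap R), Real.exp t ^ (rootChildren R p).card := by
    rw [← nsmul_eq_mul, ← Finset.sum_const]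
    refine (Finset.sum_le_sum (g := fun p => Real.exp t ^ (rootChildren R p).card)
      fun p hp => ?_).trans
      (Finset.sum_le_sum_of_subset_of_nonneg
        (fun p hp => ?_) fun p _ _ => by positivity)
    · rw [← Real.exp_nat_mul, mul_comm t]
      exact Real.exp_le_exp.2 (mul_le_mul_of_nonneg_right (Finset.mem_filter.1 hp).2.2.le ht)
    · simp only [Finset.mem_filter, Finset.mem_univ, true_and] at hp ⊢
      exact hp.1
  have h2 : (1 + Real.exp t * c) ^ (Rᶜ.card - 1) ≤
      (1 + c) ^ (Rᶜ.card - 1) * Real.exp (R.card * (Real.exp t - 1)) := by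
    have h3 : 1 + Real.exp t * c ≤ (1 + c) * Real.exp (c * (Real.exp t - 1)) := by
      have h4 := Real.add_one_le_exp (c * (Real.exp t - 1))
      nlinarith [mul_nonneg hc0 (mul_nonneg hc0 hx)]
    refine (pow_le_pow_left₀ (by positivity) h3 _).trans ?_
    rw [mul_pow, ← Real.exp_nat_mul]
    refine mul_le_mul_of_nonneg_left (Real.exp_le_exp.2 ?_) (by positivity)
    rw [← mul_assoc]
    refine mul_le_mul_of_nonneg_right ?_ hx
    calc ((Rᶜ.card - 1 : ℕ) : ℝ) * c ≤ Rᶜ.card * c :=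
          mul_le_mul_of_nonneg_right (by exact_mod_cast Nat.sub_le _ _) hc0
      _ = R.card := by rw [hc]; field_simp
  rw [sum_pow_card_rootChildren hR hRc, ← le_div_iff₀ (Real.exp_pos _)] at h1
  refine h1.trans ?_
  rw [card_isParentMap hR hRc, div_le_iff₀ (Real.exp_pos _), ← hc]
  calc _ ≤ (parentMaps R 1).card * (Real.exp t * ((1 + c) ^ (Rᶜ.card - 1) *
          Real.exp (R.card * (Real.exp t - 1)))) := by gcongr
    _ = _ := by
      rw [show t * (1 - T) + R.card * (Real.exp t - 1) =
        t + R.card * (Real.exp t - 1) - t * T by ring, Real.exp_sub, Real.exp_add]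
      field_simp

lemma IsParentMap.sum_deg_parentGraph {V : Type} [DecidableEq V] [Fintype V] {R : Finset V}
    {p : V → V} (h : IsParentMap R p) :
    ∑ r ∈ R, deg (parentGraph p) r = (rootChildren R p).card := by
  rw [Finset.card_eq_sum_card_fiberwise (f := p) (t := R)
    fun v hv => (mem_rootChildren.1 hv).2]
  refine Finset.sum_congr rfl fun r hr => ?_
  rw [deg, ← Nat.subtype_card (p := fun w => (parentGraph p).Adj r w)
    ((rootChildren R p).filter fun w => p w = r) fun w => ?_]
  rw [Finset.mem_filter, mem_rootChildren, parentGraph_adj, h.1 r hr]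
  constructor
  · rintro ⟨⟨hw, -⟩, hpw⟩
    exact ⟨ne_of_mem_of_not_mem hr hw, Or.inr hpw⟩
  · rintro ⟨hne, hrw | rfl⟩
    · exact absurd hrw hne
    · exact ⟨⟨h.notMem_of_apply_ne hne, hr⟩, rfl⟩

end Counting

section RootedForest

/-- The set of the first `k` vertices. -/
def roots (n k : ℕ) : Finset (Fin n) :=
  Finset.univ.filter fun r => r.val < k

lemma isRootedForest_iff {n k : ℕ} {F : SimpleGraph (Fin n)} :
    IsRootedForest n k F ↔ ∃ p, IsParentMap (roots n k) p ∧ parentGraph p = F := by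
  constructor
  · rintro ⟨hF, hR⟩
    exact exists_isParentMap_parentGraph_eq hF (by simpa [roots] using hR)
  · rintro ⟨p, hp, rfl⟩
    exact ⟨hp.parentGraph_isAcyclic, by simpa [roots] using hp.existsUnique_root⟩

open Classical in
lemma card_filter_isRootedForest (n k : ℕ) (E : Set (SimpleGraph (Fin n))) :
    (Finset.univ.filter fun F => IsRootedForest n k F ∧ F ∈ E).card =
      (Finset.univ.filter fun p => IsParentMap (roots n k) p ∧ parentGraph p ∈ E).card := by
  symm
  refine Finset.card_nbij parentGraph ?_ ?_ ?_
  · intro p hp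
    simp only [Finset.coe_filter, Finset.mem_univ, true_and, Set.mem_ofPred_eq] at hp ⊢
    exact ⟨isRootedForest_iff.2 ⟨p, hp.1, rfl⟩, hp.2⟩
  · intro p hp q hq hpq
    simp only [Finset.coe_filter, Finset.mem_univ, true_and, Set.mem_ofPred_eq] at hp hq
    exact hp.1.eq_of_parentGraph_eq hq.1 hpq
  · intro F hF
    simp only [Finset.coe_filter, Finset.mem_univ, true_and, Set.mem_ofPred_eq] at hF
    obtain ⟨p, hp, rfl⟩ := isRootedForest_iff.1 hF.1
    exact ⟨p, by simpa using ⟨hp, hF.2⟩, rfl⟩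

lemma rfProb_nonneg (n k : ℕ) (E : Set (SimpleGraph (Fin n))) : 0 ≤ rfProb n k E := by
  unfold rfProb
  positivity

/-- Chernoff bound for the total degree of the roots of a random forest. -/
lemma rfProb_sum_deg_le {n k : ℕ} (hk : 0 < k) (hkn : k < n) (T : ℝ) {t : ℝ} (ht : 0 ≤ t) :
    rfProb n k {F | T < ((∑ r ∈ Finset.univ.filter (fun r : Fin n => r.val < k), deg F r : ℕ) : ℝ)}
      ≤ Real.exp (t * (1 - T) + k * (Real.exp t - 1)) := by
  classical
  have hcard : (roots n k).card = k := by
    rw [roots, Fin.card_filter_val_lt, min_eq_right hkn.le]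
  have hR : (roots n k).Nonempty := Finset.card_pos.1 (by omega)
  have hRc : (roots n k)ᶜ.Nonempty := Finset.card_pos.1 (by
    rw [Finset.card_compl, hcard, Fintype.card_fin]; omega)
  have htot := card_filter_isRootedForest n k Set.univ
  simp only [Set.mem_univ, and_true] at htot
  rw [rfProb, card_filter_isRootedForest, htot]
  refine div_le_of_le_mul₀ (Nat.cast_nonneg _) (Real.exp_pos _).le ?_
  have h := card_filter_rootChildren_le hR hRc T ht
  rw [hcard] at h
  rw [Finset.filter_congr fun p _ => and_congr_right fun hp => by
    rw [← hp.sum_deg_parentGraph]] at h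
  exact h

lemma exp_sub_one_le {x : ℝ} (h0 : 0 ≤ x) (h1 : x ≤ 1 / 4) :
    Real.exp x - 1 ≤ x + 4 / 7 * x ^ 2 := by
  have h := Real.exp_bound' h0 (h1.trans (by norm_num)) (n := 3) (by norm_num)
  simp only [Finset.sum_range_succ, Finset.sum_range_zero, Nat.factorial] at h
  norm_num at h
  nlinarith [mul_le_mul_of_nonneg_left h1 (sq_nonneg x)]

lemma rfProb_many_root_neighbors_le {n k : ℕ} (hk : 0 < k) (hkn : k < n)
    (hL : 7 ≤ Real.log n) :
    rfProb n k {F | (k : ℝ) * (1 + 1 / Real.log n) + 2 * Real.log n ^ 2 <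
      ((∑ r ∈ Finset.univ.filter (fun r : Fin n => r.val < k), deg F r : ℕ) : ℝ)} ≤
      Real.exp (1 - 7 / 2 * Real.log n) := by
  set L := Real.log n
  have hL0 : 0 < L := by linarith
  have ht : 7 / (4 * L) ≤ 1 / 4 := by
    rw [div_le_div_iff₀ (by positivity) (by norm_num)]
    linarith
  refine (rfProb_sum_deg_le hk hkn _ (t := 7 / (4 * L)) (by positivity)).trans
    (Real.exp_le_exp.2 ?_)
  have h1 := mul_le_mul_of_nonneg_left (exp_sub_one_le (by positivity) ht) (Nat.cast_nonneg k)
  have h2 : 7 / (4 * L) * (1 - (k * (1 + 1 / L) + 2 * L ^ 2)) +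
      k * (7 / (4 * L) + 4 / 7 * (7 / (4 * L)) ^ 2) = 7 / (4 * L) - 7 / 2 * L := by
    field_simp
    ring
  linarith

end RootedForest

end FODef


theorem statement17 (k : ℕ → ℕ) (hpos : ∀ n, 1 ≤ k n)
    (hk : ∀ᶠ n in atTop, (k n : ℝ) ≤ Real.log n ^ 4) :
    Tendsto (fun n : ℕ => (n : ℝ) ^ 3 * rfProb n (k n)
        {F | (k n : ℝ) * (1 + 1 / Real.log n) + 2 * Real.log n ^ 2 <
          ((∑ r ∈ Finset.univ.filter (fun r : Fin n => r.val < k n), deg F r : ℕ) : ℝ)})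
      atTop (nhds 0) := by
  have hlog : Tendsto (fun n : ℕ => Real.log n) atTop atTop :=
    Real.tendsto_log_atTop.comp tendsto_natCast_atTop_atTop
  have hlt : ∀ᶠ n : ℕ in atTop, k n < n := by
    have h := (Real.isLittleO_pow_log_id_atTop (n := 4)).comp_tendsto
      (tendsto_natCast_atTop_atTop (R := ℝ))
    filter_upwards [hk, h.bound (c := 1 / 2) (by norm_num), eventually_gt_atTop 0]
      with n h1 h2 h3
    have h4 : (0 : ℝ) < n := by exact_mod_cast h3
    simp only [Function.comp_apply, id, Real.norm_eq_abs, abs_of_pos h4] at h2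
    have h5 := le_abs_self (Real.log n ^ 4)
    exact_mod_cast (by linarith : (k n : ℝ) < n)
  have hlim : Tendsto (fun n : ℕ => Real.exp (1 - Real.log n / 2)) atTop (nhds 0) :=
    Real.tendsto_exp_atBot.comp
      (tendsto_atBot_add_const_left _ 1
        (tendsto_neg_atTop_atBot.comp (hlog.atTop_div_const two_pos)))
  refine squeeze_zero' (Eventually.of_forall fun n =>
    mul_nonneg (by positivity) (rfProb_nonneg _ _ _)) ?_ hlim
  filter_upwards [hlt, hlog.eventually_ge_atTop 7, eventually_gt_atTop 0] with n hn hL hn0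
  have hpow : (n : ℝ) ^ 3 = Real.exp (3 * Real.log n) := by
    rw [← Real.exp_log (Nat.cast_pos.2 hn0 : (0 : ℝ) < n), ← Real.exp_nat_mul, Real.log_exp]
    norm_num
  calc _ ≤ (n : ℝ) ^ 3 * Real.exp (1 - 7 / 2 * Real.log n) :=
        mul_le_mul_of_nonneg_left (rfProb_many_root_neighbors_le (hpos n) hn hL) (by positivity)
    _ = _ := by
      rw [hpow, ← Real.exp_add]
      ring_nf
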